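/- arXiv:1402.6563 — 2 statements merged into one kernel-verified Lean document; each statement's English description precedes it below -/
import Mathlib

section
/- (Flux bound for the enstrophy) For every constant C₁ > 0 there exists C₄ > 0 with the following property. Let M ≥ 0 and let u : Ω → ℝ² be a smooth divergence-free vector field with ∫₀¹ u₁(x₁,x₂) dx₂ = 0 for all x₁, whose vorticity ω = ∂₁u₂ − ∂₂u₁ is smooth and bounded; suppose there is a smooth v₁ : Ω → ℝ with ∂₂v₁ = u₁ and ‖v₁‖_{L∞(Ω)} ≤ C₁M. Define ε(x₁) = (1/2)∫₀¹ ω(x₁,x₂)² dx₂, ζ(x₁) = (1/2)∫₀¹ ω(x₁,x₂)² u₁(x₁,x₂) dx₂, δ(x₁) = ∫₀¹ |∇ω(x₁,x₂)|² dx₂, and φ = ∂₁ε − ζ. Then for every x₁ ∈ ℝ: |φ(x₁)|² ≤ C₄(1+M)² ε(x₁) δ(x₁) and |∂₁ε(x₁)|² ≤ 2 ε(x₁) δ(x₁). -/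
noncomputable section

open MeasureTheory Real

namespace NS

/-- First partial derivative of a function on `ℝ²`. -/
def pd1 (g : ℝ × ℝ → ℝ) (x : ℝ × ℝ) : ℝ := deriv (fun y => g (y, x.2)) x.1

/-- Second partial derivative of a function on `ℝ²`. -/
def pd2 (g : ℝ × ℝ → ℝ) (x : ℝ × ℝ) : ℝ := deriv (fun y => g (x.1, y)) x.2

/-- Vorticity `ω = ∂₁u₂ - ∂₂u₁`. -/
def vort (u : ℝ × ℝ → ℝ × ℝ) (x : ℝ × ℝ) : ℝ :=
  pd1 (fun y => (u y).2) x - pd2 (fun y => (u y).1) x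

/-- Enstrophy density `ε(x₁) = (1/2)∫₀¹ ω² dx₂`. -/
def epsDen (u : ℝ × ℝ → ℝ × ℝ) (y : ℝ) : ℝ :=
  (1/2) * ∫ x₂ in (0:ℝ)..1, vort u (y, x₂) ^ 2

/-- Inviscid enstrophy flux `ζ(x₁) = (1/2)∫₀¹ ω² u₁ dx₂`. -/
def zetaFlux (u : ℝ × ℝ → ℝ × ℝ) (y : ℝ) : ℝ :=
  (1/2) * ∫ x₂ in (0:ℝ)..1, vort u (y, x₂) ^ 2 * (u (y, x₂)).1

/-- Enstrophy dissipation rate `δ(x₁) = ∫₀¹ |∇ω|² dx₂`. -/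
def deltaDiss (u : ℝ × ℝ → ℝ × ℝ) (y : ℝ) : ℝ :=
  ∫ x₂ in (0:ℝ)..1, (pd1 (vort u) (y, x₂) ^ 2 + pd2 (vort u) (y, x₂) ^ 2)

/-- The Cauchy–Schwarz inequality for continuous functions on `[0, 1]`. -/
lemma sq_integral_mul_le {f g : ℝ → ℝ} (hf : Continuous f) (hg : Continuous g) :
    (∫ t in (0:ℝ)..1, f t * g t) ^ 2 ≤
      (∫ t in (0:ℝ)..1, f t ^ 2) * ∫ t in (0:ℝ)..1, g t ^ 2 := by
  have key : ∀ s : ℝ, 0 ≤ (∫ t in (0:ℝ)..1, f t ^ 2) * (s * s) +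
      (2 * ∫ t in (0:ℝ)..1, f t * g t) * s + ∫ t in (0:ℝ)..1, g t ^ 2 := by
    intro s
    have hnn : 0 ≤ ∫ t in (0:ℝ)..1, (s * f t + g t) ^ 2 :=
      intervalIntegral.integral_nonneg zero_le_one fun t _ => sq_nonneg _
    have heq : ∫ t in (0:ℝ)..1, (s * f t + g t) ^ 2 =
        (s * s) * (∫ t in (0:ℝ)..1, f t ^ 2) + (2 * s) * (∫ t in (0:ℝ)..1, f t * g t) +
          ∫ t in (0:ℝ)..1, g t ^ 2 := by
      rw [← intervalIntegral.integral_const_mul, ← intervalIntegral.integral_const_mul,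
        ← intervalIntegral.integral_add, ← intervalIntegral.integral_add]
      · congr 1 with t
        ring
      all_goals exact Continuous.intervalIntegrable (by fun_prop) _ _
    linarith
  have := discrim_le_zero key
  rw [discrim] at this
  linarith

lemma hasDerivAt_pd1 {g : ℝ × ℝ → ℝ} (hg : Differentiable ℝ g) (a b : ℝ) :
    HasDerivAt (fun y => g (y, b)) (pd1 g (a, b)) a := by
  have h : Differentiable ℝ fun y : ℝ => g (y, b) := by fun_prop
  exact (h a).hasDerivAt

lemma hasDerivAt_pd2 {g : ℝ × ℝ → ℝ} (hg : Differentiable ℝ g) (a b : ℝ) :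
    HasDerivAt (fun y => g (a, y)) (pd2 g (a, b)) b := by
  have h : Differentiable ℝ fun y : ℝ => g (a, y) := by fun_prop
  exact (h b).hasDerivAt

lemma pd1_eq_fderiv {g : ℝ × ℝ → ℝ} (hg : Differentiable ℝ g) :
    pd1 g = fun x => fderiv ℝ g x (1, 0) := by
  ext ⟨a, b⟩
  exact (hasDerivAt_pd1 hg a b).unique ((hg (a, b)).hasFDerivAt.comp_hasDerivAt a
    ((hasDerivAt_id a).prodMk (hasDerivAt_const a b)))

lemma pd2_eq_fderiv {g : ℝ × ℝ → ℝ} (hg : Differentiable ℝ g) :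
    pd2 g = fun x => fderiv ℝ g x (0, 1) := by
  ext ⟨a, b⟩
  exact (hasDerivAt_pd2 hg a b).unique ((hg (a, b)).hasFDerivAt.comp_hasDerivAt b
    ((hasDerivAt_const b a).prodMk (hasDerivAt_id b)))

lemma contDiff_pd1 {g : ℝ × ℝ → ℝ} (hg : ContDiff ℝ (⊤ : ℕ∞) g) :
    ContDiff ℝ (⊤ : ℕ∞) (pd1 g) := by
  rw [pd1_eq_fderiv (hg.differentiable (by simp))]
  exact (hg.fderiv_right (by simp)).clm_apply contDiff_const

lemma contDiff_pd2 {g : ℝ × ℝ → ℝ} (hg : ContDiff ℝ (⊤ : ℕ∞) g) :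
    ContDiff ℝ (⊤ : ℕ∞) (pd2 g) := by
  rw [pd2_eq_fderiv (hg.differentiable (by simp))]
  exact (hg.fderiv_right (by simp)).clm_apply contDiff_const

lemma contDiff_vort {u : ℝ × ℝ → ℝ × ℝ} (hu : ContDiff ℝ (⊤ : ℕ∞) u) :
    ContDiff ℝ (⊤ : ℕ∞) (vort u) :=
  (contDiff_pd1 hu.snd).sub (contDiff_pd2 hu.fst)

lemma vort_periodic {u : ℝ × ℝ → ℝ × ℝ} (hper : ∀ x : ℝ × ℝ, u (x.1, x.2 + 1) = u x) (a b : ℝ) :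
    vort u (a, b + 1) = vort u (a, b) := by
  simp only [vort, pd1, pd2]
  rw [← deriv_comp_add_const]
  simp only [fun y z => hper (y, z)]

/-- Differentiation under the integral sign for the square of a `C¹` function. -/
lemma hasDerivAt_integral_sq {w : ℝ × ℝ → ℝ} (hw : Differentiable ℝ w)
    (hw' : Continuous (pd1 w)) (a : ℝ) :
    HasDerivAt (fun y => ∫ t in (0:ℝ)..1, w (y, t) ^ 2)
      (∫ t in (0:ℝ)..1, 2 * (w (a, t) * pd1 w (a, t))) a := by
  have hwc := hw.continuous
  have hF : Continuous fun x : ℝ × ℝ => 2 * (w x * pd1 w x) := by fun_prop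
  obtain ⟨B, hB⟩ := (((isCompact_Icc (a := a - 1) (b := a + 1)).prod
    (isCompact_Icc (a := (0:ℝ)) (b := 1))).exists_bound_of_continuousOn hF.continuousOn)
  refine (intervalIntegral.hasDerivAt_integral_of_dominated_loc_of_deriv_le
    (F' := fun y t => 2 * (w (y, t) * pd1 w (y, t))) (bound := fun _ => B)
    (Icc_mem_nhds (sub_one_lt a) (lt_add_one a)) (.of_forall fun y => ?_) ?_ ?_
    (.of_forall fun t ht y hy => ?_) ?_ (.of_forall fun t _ y _ => ?_)).2
  · exact Continuous.aestronglyMeasurable (by fun_prop)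
  · exact Continuous.intervalIntegrable (by fun_prop) _ _
  · exact Continuous.aestronglyMeasurable (by fun_prop)
  · rw [Set.uIoc_of_le zero_le_one] at ht
    exact hB (y, t) ⟨hy, Set.Ioc_subset_Icc_self ht⟩
  · exact intervalIntegrable_const
  · exact ((hasDerivAt_pd1 hw y t).fun_pow 2).congr_deriv (by norm_num; ring)

lemma deriv_epsDen {u : ℝ × ℝ → ℝ × ℝ} (hu : ContDiff ℝ (⊤ : ℕ∞) u) (a : ℝ) :
    deriv (epsDen u) a = ∫ t in (0:ℝ)..1, vort u (a, t) * pd1 (vort u) (a, t) := by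
  have hw := contDiff_vort hu
  have h := (hasDerivAt_integral_sq (hw.differentiable (by simp))
    (contDiff_pd1 hw).continuous a).const_mul (1 / 2)
  rw [intervalIntegral.integral_const_mul] at h
  refine h.deriv.trans ?_
  ring

/-- Integration by parts in the periodic variable rewrites the flux through a primitive of `u₁`. -/
lemma zetaFlux_eq {u : ℝ × ℝ → ℝ × ℝ} {v : ℝ × ℝ → ℝ} (hu : ContDiff ℝ (⊤ : ℕ∞) u)
    (hper : ∀ x : ℝ × ℝ, u (x.1, x.2 + 1) = u x) (hv : Differentiable ℝ v)
    (hvper : ∀ x : ℝ × ℝ, v (x.1, x.2 + 1) = v x)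
    (huv : ∀ x : ℝ × ℝ, pd2 v x = (u x).1) (a : ℝ) :
    zetaFlux u a = -∫ t in (0:ℝ)..1, vort u (a, t) * (pd2 (vort u) (a, t) * v (a, t)) := by
  have hw := contDiff_vort hu
  have hwd : Differentiable ℝ (vort u) := hw.differentiable (by simp)
  have hwc := hw.continuous
  have hwc' := (contDiff_pd2 hw).continuous
  have huc := hu.continuous
  have hibp := intervalIntegral.integral_mul_deriv_eq_deriv_mul (a := 0) (b := 1)
    (u := fun t => vort u (a, t) ^ 2) (v := fun t => v (a, t))
    (u' := fun t => 2 * (vort u (a, t) * pd2 (vort u) (a, t))) (v' := fun t => (u (a, t)).1)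
    (fun t _ => ((hasDerivAt_pd2 hwd a t).fun_pow 2).congr_deriv (by norm_num; ring))
    (fun t _ => huv (a, t) ▸ hasDerivAt_pd2 hv a t)
    (Continuous.intervalIntegrable (by fun_prop) _ _)
    (Continuous.intervalIntegrable (by fun_prop) _ _)
  have h1 : vort u (a, 1) = vort u (a, 0) := by simpa using vort_periodic hper a 0
  have h2 : v (a, 1) = v (a, 0) := by simpa using hvper (a, 0)
  have h3 : ∫ t in (0:ℝ)..1, 2 * (vort u (a, t) * pd2 (vort u) (a, t)) * v (a, t) =
      2 * ∫ t in (0:ℝ)..1, vort u (a, t) * (pd2 (vort u) (a, t) * v (a, t)) := by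
    rw [← intervalIntegral.integral_const_mul]
    congr 1 with t
    ring
  rw [zetaFlux, hibp, h1, h2, h3]
  ring

/-- Testing the vorticity against any `g` whose square is at most `K` times `|∇ω|²`. -/
lemma sq_integral_vort_mul_le {u : ℝ × ℝ → ℝ × ℝ} (hu : ContDiff ℝ (⊤ : ℕ∞) u) {a K : ℝ}
    {g : ℝ → ℝ} (hg : Continuous g)
    (hgK : ∀ t, g t ^ 2 ≤ K * (pd1 (vort u) (a, t) ^ 2 + pd2 (vort u) (a, t) ^ 2)) :
    (∫ t in (0:ℝ)..1, vort u (a, t) * g t) ^ 2 ≤ 2 * epsDen u a * (K * deltaDiss u a) := by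
  have hw := contDiff_vort hu
  have hwc := hw.continuous
  have hwc1 := (contDiff_pd1 hw).continuous
  have hwc2 := (contDiff_pd2 hw).continuous
  have hmono : ∫ t in (0:ℝ)..1, g t ^ 2 ≤ K * deltaDiss u a := by
    rw [deltaDiss, ← intervalIntegral.integral_const_mul]
    refine intervalIntegral.integral_mono_on zero_le_one ?_ ?_ fun t _ => hgK t
    all_goals exact Continuous.intervalIntegrable (by fun_prop) _ _
  have heps : 2 * epsDen u a = ∫ t in (0:ℝ)..1, vort u (a, t) ^ 2 := by
    rw [epsDen]
    ring
  rw [heps]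
  exact (sq_integral_mul_le (by fun_prop) hg).trans <| mul_le_mul_of_nonneg_left hmono <|
    intervalIntegral.integral_nonneg zero_le_one fun t _ => sq_nonneg _

/-- Flux bound for the enstrophy: with `φ = ∂₁ε - ζ`,
`|φ|² ≤ C₄(1+M)² ε δ` and `|∂₁ε|² ≤ 2 ε δ`. -/
theorem enstrophy_flux_bound :
    ∀ C₁ > (0:ℝ), ∃ C₄ > (0:ℝ),
      ∀ M : ℝ, 0 ≤ M → ∀ (u : ℝ × ℝ → ℝ × ℝ) (v₁ : ℝ × ℝ → ℝ),
      ContDiff ℝ (⊤ : ℕ∞) u →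
      (∀ x : ℝ × ℝ, u (x.1, x.2 + 1) = u x) →
      (∀ x : ℝ × ℝ, pd1 (fun y => (u y).1) x + pd2 (fun y => (u y).2) x = 0) →
      (∀ x₁ : ℝ, (∫ x₂ in (0:ℝ)..1, (u (x₁, x₂)).1) = 0) →
      (∃ B : ℝ, ∀ x : ℝ × ℝ, |vort u x| ≤ B) →
      ContDiff ℝ (⊤ : ℕ∞) v₁ →
      (∀ x : ℝ × ℝ, v₁ (x.1, x.2 + 1) = v₁ x) →
      (∀ x : ℝ × ℝ, pd2 v₁ x = (u x).1) →
      (∀ x : ℝ × ℝ, |v₁ x| ≤ C₁ * M) →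
      ∀ x₁ : ℝ,
        (deriv (epsDen u) x₁ - zetaFlux u x₁) ^ 2
            ≤ C₄ * (1 + M) ^ 2 * epsDen u x₁ * deltaDiss u x₁ ∧
        (deriv (epsDen u) x₁) ^ 2 ≤ 2 * epsDen u x₁ * deltaDiss u x₁ := by
  intro C₁ _
  refine ⟨2 * (1 + C₁ ^ 2), by positivity, ?_⟩
  intro M hM u v₁ hu hper _ _ _ hv hvper huv hvM x₁
  have hw := contDiff_vort hu
  have hwc := hw.continuous
  have hwc1 := (contDiff_pd1 hw).continuous
  have hwc2 := (contDiff_pd2 hw).continuous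
  have hvc := hv.continuous
  have heps : 0 ≤ epsDen u x₁ := mul_nonneg (by norm_num) <|
    intervalIntegral.integral_nonneg zero_le_one fun t _ => sq_nonneg _
  have hdel : 0 ≤ deltaDiss u x₁ :=
    intervalIntegral.integral_nonneg zero_le_one fun t _ => by positivity
  have hflux : deriv (epsDen u) x₁ - zetaFlux u x₁ = ∫ t in (0:ℝ)..1,
      vort u (x₁, t) * (pd1 (vort u) (x₁, t) + pd2 (vort u) (x₁, t) * v₁ (x₁, t)) := by
    rw [deriv_epsDen hu, zetaFlux_eq hu hper (hv.differentiable (by simp)) hvper huv, sub_neg_eq_add,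
      ← intervalIntegral.integral_add]
    · congr 1 with t
      ring
    all_goals exact Continuous.intervalIntegrable (by fun_prop) _ _
  constructor
  · have hbound := sq_integral_vort_mul_le hu (a := x₁) (K := 1 + (C₁ * M) ^ 2)
      (g := fun t => pd1 (vort u) (x₁, t) + pd2 (vort u) (x₁, t) * v₁ (x₁, t)) (by fun_prop)
      fun t => by
        have hv2 : v₁ (x₁, t) ^ 2 ≤ (C₁ * M) ^ 2 := sq_le_sq' (abs_le.mp (hvM _)).1
          (abs_le.mp (hvM _)).2
        nlinarith [sq_nonneg (pd1 (vort u) (x₁, t) * v₁ (x₁, t) - pd2 (vort u) (x₁, t)),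
          mul_nonneg (add_nonneg (sq_nonneg (pd1 (vort u) (x₁, t)))
            (sq_nonneg (pd2 (vort u) (x₁, t)))) (sub_nonneg.mpr hv2)]
    have hconst : 1 + (C₁ * M) ^ 2 ≤ (1 + C₁ ^ 2) * (1 + M) ^ 2 := by
      nlinarith [mul_nonneg (sq_nonneg C₁) hM, sq_nonneg C₁, sq_nonneg M]
    rw [hflux]
    nlinarith [mul_le_mul_of_nonneg_left hconst (mul_nonneg heps hdel)]
  · rw [deriv_epsDen hu]
    simpa using sq_integral_vort_mul_le hu (a := x₁) (K := 1)
      (g := fun t => pd1 (vort u) (x₁, t)) (by fun_prop)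
      fun t => by nlinarith [sq_nonneg (pd2 (vort u) (x₁, t))]

end NS
end
end

section
/- (Localized enstrophy estimate) For all constants C₃ > 0, C₄ > 0 there exists C₅ > 0 with the following property. Let M ≥ 0 and β = C₃(1+M)². Let e, f, d and ε, φ, δ be smooth functions on ℝ × [0,∞), bounded together with their first-order derivatives, with e, d, ε, δ ≥ 0, satisfying ∂_t e = ∂₁ f − d, f² ≤ β e d, ∂_t ε = ∂₁ φ − δ, φ² ≤ C₄(1+M)² ε δ, and ε(x₁,t) ≤ d(x₁,t) everywhere. Let e₀ = sup_{x₁∈ℝ} e(x₁, 0) < ∞. Fix T > 0, set ρ = 1/√(βT) and χ_ρ(x₁) = exp(−ρ|x₁|). Then ∫_ℝ χ_ρ(x₁) ε(x₁,T) dx₁ + (1/2) ∫_{T/2}^T ∫_ℝ χ_ρ(x₁) δ(x₁,t) dx₁ dt ≤ C₅ (1+M) e₀ / √T. -/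
noncomputable section

open MeasureTheory Real

namespace NS

theorem integral_exp_neg_mul_abs {ρ : ℝ} (hρ : 0 < ρ) :
    ∫ x : ℝ, exp (-ρ * |x|) = 2 / ρ := by
  rw [integral_comp_abs (f := fun x => exp (-ρ * x)), integral_exp_mul_Ioi (by linarith)]
  simp
  field_simp

theorem integrable_exp_neg_mul_abs {ρ : ℝ} (hρ : 0 < ρ) :
    Integrable fun x : ℝ => exp (-ρ * |x|) := by
  by_contra h
  have h2 := integral_exp_neg_mul_abs hρ
  rw [integral_undef h] at h2
  have : 0 < 2 / ρ := by positivity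
  linarith

theorem integrable_exp_neg_mul_abs_mul {ρ B : ℝ} (hρ : 0 < ρ) {u : ℝ → ℝ}
    (hu : AEStronglyMeasurable u) (hb : ∀ x, |u x| ≤ B) :
    Integrable fun x : ℝ => exp (-ρ * |x|) * u x :=
  (integrable_exp_neg_mul_abs hρ).mul_bdd hu (Filter.Eventually.of_forall hb)

/-- Half-line integration by parts against an exponential weight. -/
theorem setIntegral_Ioi_exp_mul_deriv_sub {ρ B : ℝ} (hρ : 0 < ρ) {g : ℝ → ℝ}
    (hg : Differentiable ℝ g) (hb : ∀ x, |g x| ≤ B) (hb' : ∀ x, |deriv g x| ≤ B) :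
    ∫ x in Set.Ioi 0, exp (-ρ * |x|) * (deriv g x - ρ * g x) = -g 0 := by
  have hint : Integrable fun x : ℝ => exp (-ρ * |x|) * (deriv g x - ρ * g x) := by
    refine integrable_exp_neg_mul_abs_mul (B := B + ρ * B) hρ
      (((measurable_deriv g).sub (hg.continuous.measurable.const_mul ρ)).aestronglyMeasurable) ?_
    intro x
    calc |deriv g x - ρ * g x| ≤ |deriv g x| + |ρ * g x| := abs_sub _ _
      _ ≤ B + ρ * B := by
        rw [abs_mul, abs_of_pos hρ]
        gcongr
        exacts [hb' x, hb x]
  have heq : ∀ x ∈ Set.Ioi (0 : ℝ), exp (-ρ * |x|) * (deriv g x - ρ * g x)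
      = exp (-ρ * x) * (deriv g x - ρ * g x) := fun x hx => by
    rw [abs_of_pos hx]
  rw [setIntegral_congr_fun measurableSet_Ioi heq,
    integral_Ioi_of_hasDerivAt_of_tendsto' (f := fun x => exp (-ρ * x) * g x) (m := 0)]
  · simp
  · intro x _
    have h1 : HasDerivAt (fun x => exp (-ρ * x)) (exp (-ρ * x) * (-ρ * 1)) x :=
      ((hasDerivAt_id x).const_mul (-ρ)).exp
    exact (h1.mul (hg x).hasDerivAt).congr_deriv (by ring)
  · exact hint.integrableOn.congr_fun heq measurableSet_Ioi
  · refine (Filter.Tendsto.zero_mul_isBoundedUnder_le ?_ ?_)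
    · exact tendsto_exp_atBot.comp
        ((Filter.tendsto_const_mul_atBot_of_neg (by linarith)).2 Filter.tendsto_id)
    · exact Filter.isBoundedUnder_of ⟨B, hb⟩

theorem integral_exp_neg_mul_abs_mul_deriv_le {ρ B : ℝ} (hρ : 0 < ρ) {g : ℝ → ℝ}
    (hg : Differentiable ℝ g) (hb : ∀ x, |g x| ≤ B) (hb' : ∀ x, |deriv g x| ≤ B) :
    ∫ x, exp (-ρ * |x|) * deriv g x ≤ ∫ x, exp (-ρ * |x|) * (ρ * |g x|) := by
  have hm : AEStronglyMeasurable (deriv g) := (measurable_deriv g).aestronglyMeasurable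
  have hi1 : Integrable fun x => exp (-ρ * |x|) * deriv g x :=
    integrable_exp_neg_mul_abs_mul hρ hm hb'
  have hi2 : Integrable fun x => exp (-ρ * |x|) * (ρ * |g x|) := by
    refine integrable_exp_neg_mul_abs_mul (B := ρ * B) hρ
      (continuous_const.mul hg.continuous.abs).aestronglyMeasurable fun x => ?_
    rw [abs_mul, abs_of_pos hρ, abs_abs]
    gcongr
    exact hb x
  have key : ∀ h : ℝ → ℝ, Differentiable ℝ h → (∀ x, |h x| ≤ B) → (∀ x, |deriv h x| ≤ B) →
      ∫ x in Set.Ioi 0, exp (-ρ * |x|) * deriv h x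
        ≤ -h 0 + ∫ x in Set.Ioi 0, exp (-ρ * |x|) * (ρ * |h x|) := by
    intro h hh hhb hhb'
    have j1 : Integrable fun x => exp (-ρ * |x|) * deriv h x :=
      integrable_exp_neg_mul_abs_mul hρ (measurable_deriv h).aestronglyMeasurable hhb'
    have bd : ∀ x, ρ * |h x| ≤ ρ * B := fun x => by gcongr; exact hhb x
    have j2 : Integrable fun x => exp (-ρ * |x|) * (ρ * |h x|) :=
      integrable_exp_neg_mul_abs_mul (B := ρ * B) hρ
        (continuous_const.mul hh.continuous.abs).aestronglyMeasurable fun x => by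
          rw [abs_mul, abs_of_pos hρ, abs_abs]; exact bd x
    have j3 : Integrable fun x => exp (-ρ * |x|) * (ρ * h x) :=
      integrable_exp_neg_mul_abs_mul (B := ρ * B) hρ
        (continuous_const.mul hh.continuous).aestronglyMeasurable fun x => by
          rw [abs_mul, abs_of_pos hρ]; exact bd x
    have hibp := setIntegral_Ioi_exp_mul_deriv_sub hρ hh hhb hhb'
    simp only [mul_sub] at hibp
    rw [integral_sub j1.integrableOn j3.integrableOn] at hibp
    have : ∫ x in Set.Ioi 0, exp (-ρ * |x|) * (ρ * h x)
        ≤ ∫ x in Set.Ioi 0, exp (-ρ * |x|) * (ρ * |h x|) := by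
      refine integral_mono j3.integrableOn j2.integrableOn fun x => ?_
      have := le_abs_self (h x)
      dsimp only
      gcongr
    linarith
  have hr := key g hg hb hb'
  have hd : ∀ x, deriv (fun x => -g (-x)) x = deriv g (-x) := fun x => by
    rw [deriv.fun_neg, deriv_comp_neg, neg_neg]
  have hl := key (fun x => -g (-x)) (hg.comp differentiable_neg).neg
    (fun x => by rw [abs_neg]; exact hb _) (fun x => by rw [hd]; exact hb' _)
  simp only [hd, abs_neg, neg_zero, neg_neg] at hl
  have r1 := integral_comp_neg_Ioi 0 fun x => exp (-ρ * |x|) * deriv g x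
  have r2 := integral_comp_neg_Ioi 0 fun x => exp (-ρ * |x|) * (ρ * |g x|)
  simp only [abs_neg, neg_zero] at r1 r2
  rw [r1, r2] at hl
  rw [← intervalIntegral.integral_Iic_add_Ioi hi1.integrableOn hi1.integrableOn (b := 0),
    ← intervalIntegral.integral_Iic_add_Ioi hi2.integrableOn hi2.integrableOn (b := 0)]
  linarith

theorem continuousOn_integral_exp_neg_mul_abs_mul {ρ B : ℝ} (hρ : 0 < ρ) {u : ℝ → ℝ → ℝ}
    (hu : ContinuousOn (fun q : ℝ × ℝ => u q.1 q.2) {q : ℝ × ℝ | 0 ≤ q.2})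
    (hb : ∀ x t, 0 ≤ t → |u x t| ≤ B) :
    ContinuousOn (fun t => ∫ x, exp (-ρ * |x|) * u x t) (Set.Ici 0) := by
  refine continuousOn_of_dominated (bound := fun x => exp (-ρ * |x|) * B) ?_ ?_
    ((integrable_exp_neg_mul_abs hρ).mul_const B) ?_
  · intro t ht
    have : Continuous fun x => u x t :=
      hu.comp_continuous (f := fun x : ℝ => (x, t)) (by fun_prop) fun _ => ht
    exact Continuous.aestronglyMeasurable (by fun_prop)
  · refine fun t ht => Filter.Eventually.of_forall fun x => ?_
    rw [norm_mul, norm_of_nonneg (exp_pos _).le]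
    gcongr
    exact hb x t ht
  · refine Filter.Eventually.of_forall fun x => continuousOn_const.mul ?_
    exact hu.comp (f := fun t : ℝ => (x, t)) (by fun_prop) fun _ ht => ht

/-- The weighted energy of a dissipative triple `(e, f, d)` satisfies a differential inequality. -/
theorem exists_hasDerivAt_weighted_energy {ρ B γ : ℝ} (hρ : 0 < ρ) {e f d : ℝ → ℝ → ℝ}
    (he : ContDiffOn ℝ (⊤ : ℕ∞) (fun q : ℝ × ℝ => e q.1 q.2) {q : ℝ × ℝ | 0 ≤ q.2})
    (hf : ContDiffOn ℝ (⊤ : ℕ∞) (fun q : ℝ × ℝ => f q.1 q.2) {q : ℝ × ℝ | 0 ≤ q.2})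
    (hd : ContinuousOn (fun q : ℝ × ℝ => d q.1 q.2) {q : ℝ × ℝ | 0 ≤ q.2})
    (heB : ∀ x t, 0 ≤ t → |e x t| ≤ B) (hfB : ∀ x t, 0 ≤ t → |f x t| ≤ B)
    (hdB : ∀ x t, 0 ≤ t → |d x t| ≤ B)
    (heB' : ∀ x t, 0 ≤ t → |deriv (fun s => e x s) t| ≤ B)
    (hfB' : ∀ x t, 0 ≤ t → |deriv (fun y => f y t) x| ≤ B)
    (hγ : 0 ≤ γ) (he0 : ∀ x t, 0 ≤ t → 0 ≤ e x t) (hd0 : ∀ x t, 0 ≤ t → 0 ≤ d x t)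
    (heq : ∀ x t, 0 < t → deriv (fun s => e x s) t = deriv (fun y => f y t) x - d x t)
    (hfl : ∀ x t, 0 ≤ t → f x t ^ 2 ≤ γ * e x t * d x t) {t : ℝ} (ht : 0 < t) :
    ∃ E' : ℝ, HasDerivAt (fun s => ∫ x, exp (-ρ * |x|) * e x s) E' t ∧
      E' ≤ ρ ^ 2 * γ / 2 * (∫ x, exp (-ρ * |x|) * e x t)
        - 1 / 2 * ∫ x, exp (-ρ * |x|) * d x t := by
  have slice : ∀ {u : ℝ → ℝ → ℝ},
      ContinuousOn (fun q : ℝ × ℝ => u q.1 q.2) {q : ℝ × ℝ | 0 ≤ q.2} → ∀ s, 0 ≤ s →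
      Continuous fun x => u x s := fun hu s hs =>
    hu.comp_continuous (f := fun x : ℝ => (x, s)) (by fun_prop) fun _ => hs
  have diffAt : ∀ {u : ℝ → ℝ → ℝ},
      ContDiffOn ℝ (⊤ : ℕ∞) (fun q : ℝ × ℝ => u q.1 q.2) {q : ℝ × ℝ | 0 ≤ q.2} → ∀ x s, 0 < s →
      DifferentiableAt ℝ (fun q : ℝ × ℝ => u q.1 q.2) (x, s) := fun hu x s hs =>
    (hu.differentiableOn (by simp)).differentiableAt
      (Filter.mem_of_superset ((isOpen_lt continuous_const continuous_snd).mem_nhds hs)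
        fun q (hq : 0 < q.2) => hq.le)
  have het : ∀ x s, 0 < s → DifferentiableAt ℝ (fun s => e x s) s := fun x s hs =>
    (diffAt he x s hs).comp (f := fun s : ℝ => (x, s)) s (by fun_prop)
  have hfx : Differentiable ℝ fun y => f y t := fun x =>
    (diffAt hf x t ht).comp (f := fun y : ℝ => (y, t)) x (by fun_prop)
  have hec := slice he.continuousOn
  have hfc := slice hf.continuousOn t ht.le
  have hdc := slice hd t ht.le
  have hfm : Measurable fun x => deriv (fun y => f y t) x := measurable_deriv _
  have ie := integrable_exp_neg_mul_abs_mul hρ (hec t ht.le).aestronglyMeasurable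
    (fun x => heB x t ht.le)
  have id := integrable_exp_neg_mul_abs_mul hρ hdc.aestronglyMeasurable (fun x => hdB x t ht.le)
  have ifx := integrable_exp_neg_mul_abs_mul hρ hfm.aestronglyMeasurable (fun x => hfB' x t ht.le)
  have hder := (hasDerivAt_integral_of_dominated_loc_of_deriv_le (μ := volume) (x₀ := t)
    (s := Set.Ioi 0) (F := fun s x => exp (-ρ * |x|) * e x s)
    (F' := fun s x => exp (-ρ * |x|) * deriv (fun r => e x r) s)
    (bound := fun x => exp (-ρ * |x|) * B) (Ioi_mem_nhds ht) ?_ ie ?_ ?_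
    ((integrable_exp_neg_mul_abs hρ).mul_const B) ?_).2
  · refine ⟨_, hder, ?_⟩
    have hsplit : ∫ x, exp (-ρ * |x|) * deriv (fun r => e x r) t
        = (∫ x, exp (-ρ * |x|) * deriv (fun y => f y t) x) - ∫ x, exp (-ρ * |x|) * d x t := by
      rw [← integral_sub ifx id]
      exact integral_congr_ae (Filter.Eventually.of_forall fun x => by
        simp only [heq x t ht, mul_sub])
    have hibp := integral_exp_neg_mul_abs_mul_deriv_le hρ hfx (fun x => hfB x t ht.le)
      (fun x => hfB' x t ht.le)
    have hyoung : ∫ x, exp (-ρ * |x|) * (ρ * |f x t|)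
        ≤ ∫ x, (ρ ^ 2 * γ / 2 * (exp (-ρ * |x|) * e x t) + 1 / 2 * (exp (-ρ * |x|) * d x t)) := by
      refine integral_mono_of_nonneg (Filter.Eventually.of_forall fun x => by
        simp only [Pi.zero_apply]; positivity)
        ((ie.const_mul _).add (id.const_mul _)) (Filter.Eventually.of_forall fun x => ?_)
      have hp : ρ * |f x t| ≤ ρ ^ 2 * γ / 2 * e x t + 1 / 2 * d x t := by
        have h1 := hfl x t ht.le
        have h2 := he0 x t ht.le
        have h3 := hd0 x t ht.le
        refine abs_le_of_sq_le_sq' ?_ (by positivity) |>.2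
        rw [mul_pow, sq_abs]
        nlinarith [sq_nonneg (ρ ^ 2 * γ / 2 * e x t - 1 / 2 * d x t),
          mul_le_mul_of_nonneg_left h1 (sq_nonneg ρ)]
      dsimp only
      calc _ ≤ exp (-ρ * |x|) * (ρ ^ 2 * γ / 2 * e x t + 1 / 2 * d x t) := by gcongr
        _ = _ := by ring
    rw [integral_add (ie.const_mul _) (id.const_mul _), integral_const_mul,
      integral_const_mul] at hyoung
    linarith
  · filter_upwards [Ioi_mem_nhds ht] with s hs
    have := hec s (le_of_lt hs)
    exact Continuous.aestronglyMeasurable (by fun_prop)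
  · have : (fun x => deriv (fun r => e x r) t) = fun x => deriv (fun y => f y t) x - d x t :=
      funext fun x => heq x t ht
    have hm : Measurable fun x => deriv (fun r => e x r) t := by
      rw [this]; exact hfm.sub hdc.measurable
    exact (Measurable.mul (by fun_prop) hm).aestronglyMeasurable
  · refine Filter.Eventually.of_forall fun x s hs => ?_
    rw [norm_mul, norm_of_nonneg (exp_pos _).le]
    gcongr
    exact heB' x s (le_of_lt hs)
  · exact Filter.Eventually.of_forall fun x s hs => (het x s hs).hasDerivAt.const_mul _

/-- If `E` dissipates `D`, `F` dissipates `G`, and `F ≤ D`, then the functional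
`4 (1 + k) (1 - t / (2 T)) E + t F` controls `F` at time `T` and the integral of `G`. -/
theorem final_add_integral_le_of_dissipation {E F G D : ℝ → ℝ} {T k : ℝ} (hT : 0 < T)
    (hk : 0 ≤ k) (hEc : ContinuousOn E (Set.Ici 0)) (hFc : ContinuousOn F (Set.Ici 0))
    (hGc : ContinuousOn G (Set.Ici 0))
    (hE : ∀ t, 0 < t → ∃ E', HasDerivAt E E' t ∧ E' ≤ 1 / (2 * T) * E t - 1 / 2 * D t)
    (hF : ∀ t, 0 < t → ∃ F', HasDerivAt F F' t ∧ F' ≤ k / T * F t - 1 / 2 * G t)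
    (hE0 : ∀ t, 0 ≤ t → 0 ≤ E t) (hF0 : ∀ t, 0 ≤ t → 0 ≤ F t) (hG0 : ∀ t, 0 ≤ t → 0 ≤ G t)
    (hFD : ∀ t, 0 ≤ t → F t ≤ D t) :
    F T + 1 / 2 * ∫ t in (T / 2)..T, G t ≤ 8 * (1 + k) / T * E 0 := by
  choose! E' hE hE' using hE
  choose! F' hF hF' using hF
  set H : ℝ → ℝ := fun t => 4 * (1 + k) * (1 - t / (2 * T)) * E t + t * F t with hH
  set H' : ℝ → ℝ := fun t => (4 * (1 + k) * (-(1 / (2 * T))) * E t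
    + 4 * (1 + k) * (1 - t / (2 * T)) * E' t) + (1 * F t + t * F' t) with hH'
  have hHc : ContinuousOn H (Set.Ici 0) := by fun_prop
  have hHd : ∀ t, 0 < t → HasDerivAt H (H' t) t := fun t ht =>
    ((((hasDerivAt_id t).div_const (2 * T)).const_sub 1).const_mul (4 * (1 + k))).mul (hE t ht)
      |>.add ((hasDerivAt_id t).mul (hF t ht))
  have hle : ∀ t, 0 < t → t < T → H' t ≤ -(t / 2 * G t) := by
    intro t ht htT
    have hs : t / (2 * T) ≤ 1 / 2 := by rw [div_le_iff₀ (by positivity)]; linarith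
    have hs0 : 0 ≤ t / (2 * T) := by positivity
    have htT' : t / T ≤ 1 := by rw [div_le_one hT]; exact htT.le
    have e0 := hE0 t ht.le
    have f0 := hF0 t ht.le
    have fd := hFD t ht.le
    have h1 : 4 * (1 + k) * (1 - t / (2 * T)) * E' t ≤ 4 * (1 + k) * (1 - t / (2 * T))
        * (1 / (2 * T) * E t - 1 / 2 * D t) :=
      mul_le_mul_of_nonneg_left (hE' t ht) (mul_nonneg (by positivity) (by linarith))
    have h2 : t * F' t ≤ t * (k / T * F t - 1 / 2 * G t) :=
      mul_le_mul_of_nonneg_left (hF' t ht) ht.le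
    have h3 : (1 + k) * F t ≤ 4 * (1 + k) * (1 - t / (2 * T)) * (1 / 2 * D t) := by
      calc (1 + k) * F t ≤ (1 + k) * D t := by gcongr
        _ = 4 * (1 + k) * (1 - 1 / 2) * (1 / 2 * D t) := by ring
        _ ≤ _ := by gcongr; linarith
    have h4 : t * (k / T * F t) ≤ k * F t := by
      calc t * (k / T * F t) = t / T * (k * F t) := by ring
        _ ≤ 1 * (k * F t) := by gcongr
        _ = _ := one_mul _
    have h5 : 0 ≤ 4 * (1 + k) * (t / (2 * T)) * (1 / (2 * T) * E t) := by positivity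
    simp only [hH']
    linarith
  have hfirst : H (T / 2) - H 0 ≤ ∫ _ in (0 : ℝ)..(T / 2), (0 : ℝ) := by
    refine intervalIntegral.sub_le_integral_of_hasDeriv_right_of_le (by positivity)
      (hHc.mono fun t ht => ht.1) (fun t ht => (hHd t ht.1).hasDerivWithinAt)
      (by simp) fun t ht => ?_
    have := hle t ht.1 (by linarith [ht.2])
    have h2 : 0 ≤ t / 2 * G t := mul_nonneg (by linarith [ht.1]) (hG0 t ht.1.le)
    linarith
  have hsecond : H T - H (T / 2) ≤ ∫ t in (T / 2)..T, -(T / 4) * G t := by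
    have hpos : ∀ t, T / 2 ≤ t → 0 ≤ t := fun t ht => by linarith
    refine intervalIntegral.sub_le_integral_of_hasDeriv_right_of_le (by linarith)
      (hHc.mono fun t ht => hpos t ht.1)
      (fun t ht => (hHd t (by linarith [ht.1])).hasDerivWithinAt)
      ((continuousOn_const.mul (hGc.mono fun t ht => hpos t ht.1)).integrableOn_Icc)
      fun t ht => ?_
    have h1 := hle t (by linarith [ht.1]) ht.2
    have h2 := mul_le_mul_of_nonneg_right ht.1.le (hG0 t (hpos t ht.1.le))
    linarith
  rw [intervalIntegral.integral_const_mul] at hsecond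
  simp only [intervalIntegral.integral_zero] at hfirst
  have hHT : T * F T ≤ H T := by
    have h1 : H T = 2 * (1 + k) * E T + T * F T := by simp only [hH]; field_simp; ring
    have h2 : 0 ≤ 2 * (1 + k) * E T := mul_nonneg (by positivity) (hE0 T hT.le)
    linarith
  have hH0 : H 0 = 4 * (1 + k) * E 0 := by simp [hH]
  have hFT := mul_nonneg hT.le (hF0 T hT.le)
  rw [div_mul_eq_mul_div (8 * (1 + k)), le_div_iff₀ hT]
  linarith

/-- Localized enstrophy estimate: if `(e,f,d)` is an extended-dissipative triple with
`f² ≤ β e d`, `β = C₃(1+M)²`, and `(ε,φ,δ)` is a second triple with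
`φ² ≤ C₄(1+M)² ε δ` and `ε ≤ d`, then with `ρ = 1/√(βT)`,
`∫ χ_ρ ε(·,T) + (1/2)∫_{T/2}^T ∫ χ_ρ δ ≤ C₅ (1+M) e₀ / √T`. -/
theorem localized_enstrophy_estimate :
    ∀ C₃ > (0:ℝ), ∀ C₄ > (0:ℝ), ∃ C₅ > (0:ℝ), ∀ M : ℝ, 0 ≤ M →
    ∀ e f d eps phi del : ℝ → ℝ → ℝ,
    ContDiffOn ℝ (⊤ : ℕ∞) (fun q : ℝ × ℝ => e q.1 q.2) {q : ℝ × ℝ | 0 ≤ q.2} →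
    ContDiffOn ℝ (⊤ : ℕ∞) (fun q : ℝ × ℝ => f q.1 q.2) {q : ℝ × ℝ | 0 ≤ q.2} →
    ContDiffOn ℝ (⊤ : ℕ∞) (fun q : ℝ × ℝ => d q.1 q.2) {q : ℝ × ℝ | 0 ≤ q.2} →
    ContDiffOn ℝ (⊤ : ℕ∞) (fun q : ℝ × ℝ => eps q.1 q.2) {q : ℝ × ℝ | 0 ≤ q.2} →
    ContDiffOn ℝ (⊤ : ℕ∞) (fun q : ℝ × ℝ => phi q.1 q.2) {q : ℝ × ℝ | 0 ≤ q.2} →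
    ContDiffOn ℝ (⊤ : ℕ∞) (fun q : ℝ × ℝ => del q.1 q.2) {q : ℝ × ℝ | 0 ≤ q.2} →
    (∃ B : ℝ, ∀ x₁ t : ℝ, 0 ≤ t →
      |e x₁ t| ≤ B ∧ |f x₁ t| ≤ B ∧ |d x₁ t| ≤ B ∧
      |eps x₁ t| ≤ B ∧ |phi x₁ t| ≤ B ∧ |del x₁ t| ≤ B ∧
      |deriv (fun y => e y t) x₁| ≤ B ∧ |deriv (fun s => e x₁ s) t| ≤ B ∧
      |deriv (fun y => f y t) x₁| ≤ B ∧ |deriv (fun s => f x₁ s) t| ≤ B ∧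
      |deriv (fun y => d y t) x₁| ≤ B ∧ |deriv (fun s => d x₁ s) t| ≤ B ∧
      |deriv (fun y => eps y t) x₁| ≤ B ∧ |deriv (fun s => eps x₁ s) t| ≤ B ∧
      |deriv (fun y => phi y t) x₁| ≤ B ∧ |deriv (fun s => phi x₁ s) t| ≤ B ∧
      |deriv (fun y => del y t) x₁| ≤ B ∧ |deriv (fun s => del x₁ s) t| ≤ B) →
    (∀ x₁ t : ℝ, 0 ≤ t → 0 ≤ e x₁ t) →
    (∀ x₁ t : ℝ, 0 ≤ t → 0 ≤ d x₁ t) →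
    (∀ x₁ t : ℝ, 0 ≤ t → 0 ≤ eps x₁ t) →
    (∀ x₁ t : ℝ, 0 ≤ t → 0 ≤ del x₁ t) →
    (∀ x₁ t : ℝ, 0 < t →
      deriv (fun s => e x₁ s) t = deriv (fun y => f y t) x₁ - d x₁ t) →
    (∀ x₁ t : ℝ, 0 ≤ t → f x₁ t ^ 2 ≤ (C₃ * (1 + M) ^ 2) * e x₁ t * d x₁ t) →
    (∀ x₁ t : ℝ, 0 < t →
      deriv (fun s => eps x₁ s) t = deriv (fun y => phi y t) x₁ - del x₁ t) →
    (∀ x₁ t : ℝ, 0 ≤ t → phi x₁ t ^ 2 ≤ C₄ * (1 + M) ^ 2 * eps x₁ t * del x₁ t) →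
    (∀ x₁ t : ℝ, 0 ≤ t → eps x₁ t ≤ d x₁ t) →
    ∀ T > (0:ℝ),
      (∫ x₁ : ℝ, Real.exp (-(1 / Real.sqrt (C₃ * (1 + M) ^ 2 * T)) * |x₁|) * eps x₁ T)
        + (1/2) * ∫ t in (T/2)..T,
            ∫ x₁ : ℝ, Real.exp (-(1 / Real.sqrt (C₃ * (1 + M) ^ 2 * T)) * |x₁|) * del x₁ t
        ≤ C₅ * (1 + M) * (⨆ x₁ : ℝ, e x₁ 0) / Real.sqrt T := by
  intro C₃ hC₃ C₄ hC₄
  refine ⟨16 * (1 + C₄ / (2 * C₃)) * √C₃, by positivity, ?_⟩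
  intro M hM e f d eps phi del he hf hd heps hphi hdel ⟨B, hB⟩ he0 hd0 heps0 hdel0
    heq hfl hepseq hphil hle T hT
  have hM1 : 0 < 1 + M := by linarith
  have hsq : √(C₃ * (1 + M) ^ 2 * T) = √C₃ * (1 + M) * √T := by
    rw [sqrt_mul (by positivity), sqrt_mul hC₃.le, sqrt_sq hM1.le]
  have hρ : 0 < 1 / √(C₃ * (1 + M) ^ 2 * T) := by positivity
  have hρ2 : (1 / √(C₃ * (1 + M) ^ 2 * T)) ^ 2 = 1 / (C₃ * (1 + M) ^ 2 * T) := by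
    rw [div_pow, sq_sqrt (by positivity), one_pow]
  have hρinv : 2 / (1 / √(C₃ * (1 + M) ^ 2 * T)) = 2 * (√C₃ * (1 + M) * √T) := by
    rw [← hsq]; simp
  generalize 1 / √(C₃ * (1 + M) ^ 2 * T) = ρ at hρ hρ2 hρinv ⊢
  choose heB hfB hdB hepsB hphiB hdelB _ het hfx _ _ _ _ hepst hphix _ _ _ using hB
  set k := C₄ / (2 * C₃) with hk
  have hk0 : 0 < k := by positivity
  have hE := fun t (ht : 0 < t) => exists_hasDerivAt_weighted_energy hρ he hf hd.continuousOn
    heB hfB hdB het hfx (by positivity) he0 hd0 heq hfl ht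
  have hF := fun t (ht : 0 < t) => exists_hasDerivAt_weighted_energy hρ heps hphi
    hdel.continuousOn hepsB hphiB hdelB hepst hphix (by positivity) heps0 hdel0 hepseq hphil ht
  have hκ₁ : ρ ^ 2 * (C₃ * (1 + M) ^ 2) / 2 = 1 / (2 * T) := by rw [hρ2]; field_simp
  have hκ₂ : ρ ^ 2 * (C₄ * (1 + M) ^ 2) / 2 = k / T := by rw [hρ2, hk]; field_simp
  rw [hκ₁] at hE
  rw [hκ₂] at hF
  have hEc := continuousOn_integral_exp_neg_mul_abs_mul hρ he.continuousOn heB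
  have hFc := continuousOn_integral_exp_neg_mul_abs_mul hρ heps.continuousOn hepsB
  have hGc := continuousOn_integral_exp_neg_mul_abs_mul hρ hdel.continuousOn hdelB
  have slice : ∀ {u : ℝ → ℝ → ℝ},
      ContDiffOn ℝ (⊤ : ℕ∞) (fun q : ℝ × ℝ => u q.1 q.2) {q : ℝ × ℝ | 0 ≤ q.2} → ∀ s, 0 ≤ s →
      Continuous fun x => u x s := fun hu s hs =>
    hu.continuousOn.comp_continuous (f := fun x : ℝ => (x, s)) (by fun_prop) fun _ => hs
  have hFD : ∀ t, 0 ≤ t →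
      ∫ x, exp (-ρ * |x|) * eps x t ≤ ∫ x, exp (-ρ * |x|) * d x t := fun t ht => by
    refine integral_mono
      (integrable_exp_neg_mul_abs_mul hρ (slice heps t ht).aestronglyMeasurable
        fun x => hepsB x t ht)
      (integrable_exp_neg_mul_abs_mul hρ (slice hd t ht).aestronglyMeasurable
        fun x => hdB x t ht) fun x => ?_
    have := hle x t ht
    dsimp only
    gcongr
  have hE0 : ∀ t, 0 ≤ t → 0 ≤ ∫ x, exp (-ρ * |x|) * e x t := fun t ht =>
    integral_nonneg fun x => mul_nonneg (exp_pos _).le (he0 x t ht)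
  have hF0 : ∀ t, 0 ≤ t → 0 ≤ ∫ x, exp (-ρ * |x|) * eps x t := fun t ht =>
    integral_nonneg fun x => mul_nonneg (exp_pos _).le (heps0 x t ht)
  have hG0 : ∀ t, 0 ≤ t → 0 ≤ ∫ x, exp (-ρ * |x|) * del x t := fun t ht =>
    integral_nonneg fun x => mul_nonneg (exp_pos _).le (hdel0 x t ht)
  have hinit : ∫ x, exp (-ρ * |x|) * e x 0 ≤ 2 / ρ * ⨆ x, e x 0 := by
    rw [← integral_exp_neg_mul_abs hρ, ← integral_mul_const]
    refine integral_mono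
      (integrable_exp_neg_mul_abs_mul hρ (slice he 0 le_rfl).aestronglyMeasurable
        fun x => heB x 0 le_rfl)
      ((integrable_exp_neg_mul_abs hρ).mul_const _) fun x => ?_
    have : e x 0 ≤ ⨆ x, e x 0 :=
      le_ciSup ⟨B, by rintro _ ⟨y, rfl⟩; exact (abs_le.1 (heB y 0 le_rfl)).2⟩ x
    dsimp only
    gcongr
  rw [hρinv] at hinit
  refine (final_add_integral_le_of_dissipation hT hk0.le
    hEc hFc hGc hE hF hE0 hF0 hG0 hFD).trans ?_
  calc 8 * (1 + k) / T * ∫ x, exp (-ρ * |x|) * e x 0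
      ≤ 8 * (1 + k) / T * (2 * (√C₃ * (1 + M) * √T) * ⨆ x, e x 0) := by gcongr
    _ = 16 * (1 + k) * √C₃ * (1 + M) * (⨆ x, e x 0) * (√T / T) := by ring
    _ = _ := by rw [sqrt_div_self', mul_one_div]

end NS
end
end
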